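/- arXiv:1502.02625 — 2 statements merged into one kernel-verified Lean document; each statement's English description precedes it below -/
import Mathlib

section
/- If [i_1,…,i_N] is a stepping sequence for m, then its complement [m−i_1,…,m−i_N] is also a stepping sequence for m. -/
open List

/-- The initial configuration `(1, 2, …, m)`. -/
def initConfig (m : ℕ) : List ℕ := (List.range m).map (· + 1)

/-- A move at index `i` (with `1 ≤ i ≤ m-1`) transposes the entries `q_i` and `q_{i+1}`
(one-indexed), i.e. the entries at zero-indexed positions `i-1` and `i`. -/
def swapAdj (q : List ℕ) (i : ℕ) : List ℕ :=
  (q.set (i - 1) (q.getD i 0)).set i (q.getD (i - 1) 0)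

/-- The prefix set `S_k(q) = {q_1, …, q_k}`. -/
def prefixSet (q : List ℕ) (k : ℕ) : Finset ℕ := (q.take k).toFinset

/-- The initial prefix sets `S_0 ⊂ S_1 ⊂ … ⊂ S_m` of the configuration `(1,…,m)`. -/
def initSets (m : ℕ) : List (Finset ℕ) :=
  (List.range (m + 1)).map (fun k => prefixSet (initConfig m) k)

/-- The sets generated by applying a sequence of moves starting from configuration `q`:
the `t`-th generated set is the prefix set of length `i_t` of the configuration
obtained after the `t`-th move. -/
def genSetsAux (q : List ℕ) : List ℕ → List (Finset ℕ)
  | [] => []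
  | i :: rest => prefixSet (swapAdj q i) i :: genSetsAux (swapAdj q i) rest

/-- The sets generated by the moves, starting from the initial configuration `(1,…,m)`. -/
def genSets (m : ℕ) (moves : List ℕ) : List (Finset ℕ) :=
  genSetsAux (initConfig m) moves

/-- `moves` is a stepping sequence for `m`: each move index lies in `{1,…,m-1}`, and the
initial prefix sets `S_0,…,S_m` together with the generated sets list every subset of
`{1,…,m}` exactly once. -/
def IsSteppingSeq (m : ℕ) (moves : List ℕ) : Prop :=
  (∀ i ∈ moves, 1 ≤ i ∧ i ≤ m - 1) ∧
  (initSets m ++ genSets m moves).Perm (Finset.Icc 1 m).powerset.toList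

/-- The relabelling `x ↦ m + 1 - x` of `{1, …, m}` applied to the complement of `S`. -/
def reflectCompl (m : ℕ) (S : Finset ℕ) : Finset ℕ :=
  (Finset.Icc 1 m \ S).image (fun x => m + 1 - x)

/-- The configuration read backwards, with its entries relabelled by `x ↦ m + 1 - x`. -/
def reflectConfig (m : ℕ) (q : List ℕ) : List ℕ :=
  (q.map (fun x => m + 1 - x)).reverse

lemma mem_reflectCompl {m : ℕ} {S : Finset ℕ} {x : ℕ} :
    x ∈ reflectCompl m S ↔ (1 ≤ x ∧ x ≤ m) ∧ m + 1 - x ∉ S := by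
  simp only [reflectCompl, Finset.mem_image, Finset.mem_sdiff, Finset.mem_Icc]
  constructor
  · rintro ⟨y, ⟨hy, hyS⟩, rfl⟩
    exact ⟨by omega, by rwa [show m + 1 - (m + 1 - y) = y by omega]⟩
  · rintro ⟨hx, hxS⟩
    exact ⟨m + 1 - x, ⟨by omega, hxS⟩, by omega⟩

lemma reflectCompl_subset (m : ℕ) (S : Finset ℕ) : reflectCompl m S ⊆ Finset.Icc 1 m :=
  fun _ hx => Finset.mem_Icc.2 (mem_reflectCompl.1 hx).1

lemma reflectCompl_reflectCompl {m : ℕ} {S : Finset ℕ} (hS : S ⊆ Finset.Icc 1 m) :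
    reflectCompl m (reflectCompl m S) = S := by
  ext x
  rw [mem_reflectCompl, mem_reflectCompl]
  constructor
  · rintro ⟨hx, h⟩
    by_contra hxS
    exact h ⟨by omega, by rwa [show m + 1 - (m + 1 - x) = x by omega]⟩
  · intro hxS
    have hx := Finset.mem_Icc.1 (hS hxS)
    exact ⟨hx, fun h => h.2 (by rwa [show m + 1 - (m + 1 - x) = x by omega])⟩

lemma map_reflectCompl_powerset_perm (m : ℕ) :
    ((Finset.Icc 1 m).powerset.toList.map (reflectCompl m)).Perm
      (Finset.Icc 1 m).powerset.toList := by
  rw [List.perm_ext_iff_of_nodup _ (Finset.nodup_toList _)]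
  · intro S
    simp only [List.mem_map, Finset.mem_toList, Finset.mem_powerset]
    exact ⟨fun ⟨T, _, h⟩ => h ▸ reflectCompl_subset m T,
      fun hS => ⟨_, reflectCompl_subset m S, reflectCompl_reflectCompl hS⟩⟩
  · refine List.Nodup.map_on (fun S hS T hT h => ?_) (Finset.nodup_toList _)
    simp only [Finset.mem_toList, Finset.mem_powerset] at hS hT
    rw [← reflectCompl_reflectCompl hS, h, reflectCompl_reflectCompl hT]

lemma length_initConfig (m : ℕ) : (initConfig m).length = m := by simp [initConfig]

lemma nodup_initConfig (m : ℕ) : (initConfig m).Nodup :=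
  List.nodup_range.map (add_left_injective 1)

lemma mem_initConfig {m x : ℕ} : x ∈ initConfig m ↔ 1 ≤ x ∧ x ≤ m := by
  simp only [initConfig, List.mem_map, List.mem_range]
  exact ⟨fun ⟨y, hy, h⟩ => by omega, fun h => ⟨x - 1, by omega, by omega⟩⟩

lemma reflectConfig_initConfig (m : ℕ) : reflectConfig m (initConfig m) = initConfig m := by
  apply List.ext_getElem
  · simp [reflectConfig]
  · intro j h₁ h₂
    simp only [length_initConfig] at h₂
    simp only [reflectConfig, initConfig, List.getElem_reverse, List.getElem_map,
      List.getElem_range, List.length_map, List.length_range]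
    omega

lemma swapAdj_perm {q : List ℕ} {i : ℕ} (hi : i < q.length) : (swapAdj q i).Perm q := by
  have h : i - 1 < q.length := by omega
  rw [swapAdj, List.getD_eq_getElem _ _ hi, List.getD_eq_getElem _ _ h]
  exact List.set_set_perm h hi

lemma reflectConfig_swapAdj {m : ℕ} {q : List ℕ} {i : ℕ} (hq : q.length = m) (h1 : 1 ≤ i)
    (hi : i < m) :
    swapAdj (reflectConfig m q) (m - i) = reflectConfig m (swapAdj q i) := by
  subst hq
  apply List.ext_getElem
  · simp [swapAdj, reflectConfig]
  · intro j h₁ h₂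
    simp only [swapAdj, reflectConfig, List.length_set, List.length_reverse, List.length_map]
      at h₁
    have ha : q.length - 1 - (q.length - i - 1) = i := by omega
    have hb : q.length - 1 - (q.length - i) = i - 1 := by omega
    have hc : i - 1 < q.length := by omega
    have hd : q.length - i < q.length := by omega
    have he : q.length - i - 1 < q.length := by omega
    simp only [swapAdj, reflectConfig, List.getElem_set, List.getElem_reverse, List.getElem_map,
      List.length_map, List.length_set, List.getD_eq_getElem?_getD, List.length_reverse,
      List.getElem?_eq_getElem, hi, hc, hd, he, ha, hb, Option.getD_some]
    split_ifs <;> first | rfl | omega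

lemma prefixSet_reflectConfig {m : ℕ} {q : List ℕ} (hq : q.Perm (initConfig m)) {k : ℕ}
    (hk : k ≤ m) :
    prefixSet (reflectConfig m q) (m - k) = reflectCompl m (prefixSet q k) := by
  have hlen : q.length = m := hq.length_eq.trans (length_initConfig m)
  have hnd : (q.take k ++ q.drop k).Nodup := by
    rw [List.take_append_drop]
    exact hq.nodup_iff.2 (nodup_initConfig m)
  have hdrop : (q.drop k).toFinset = Finset.Icc 1 m \ (q.take k).toFinset := by
    ext x
    have hx : x ∈ q.take k ∨ x ∈ q.drop k ↔ 1 ≤ x ∧ x ≤ m := by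
      rw [← List.mem_append, List.take_append_drop, hq.mem_iff, mem_initConfig]
    have hdisj : x ∈ q.take k → x ∉ q.drop k :=
      fun h => List.disjoint_of_nodup_append hnd h
    simp only [List.mem_toFinset, Finset.mem_sdiff, Finset.mem_Icc]
    tauto
  rw [prefixSet, prefixSet, reflectCompl, ← hdrop, reflectConfig, List.take_reverse,
    List.length_map, hlen, show m - (m - k) = k by omega]
  ext x
  simp [← List.map_drop]

lemma genSetsAux_reflectConfig {m : ℕ} (G : List ℕ) (hG : ∀ i ∈ G, 1 ≤ i ∧ i ≤ m - 1)
    {q : List ℕ} (hq : q.Perm (initConfig m)) :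
    genSetsAux (reflectConfig m q) (G.map (fun i => m - i)) =
      (genSetsAux q G).map (reflectCompl m) := by
  induction G generalizing q with
  | nil => rfl
  | cons i G ih =>
    obtain ⟨⟨h1, hi⟩, hG⟩ := List.forall_mem_cons.1 hG
    have hlen : q.length = m := hq.length_eq.trans (length_initConfig m)
    have hq' : (swapAdj q i).Perm (initConfig m) := (swapAdj_perm (by omega)).trans hq
    simp only [List.map_cons, genSetsAux]
    rw [reflectConfig_swapAdj hlen h1 (by omega), ih hG hq',
      prefixSet_reflectConfig hq' (by omega)]

lemma map_reflectCompl_initSets (m : ℕ) :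
    (initSets m).map (reflectCompl m) = (initSets m).reverse := by
  apply List.ext_getElem
  · simp [initSets]
  · intro k h₁ h₂
    simp only [initSets, List.length_map, List.length_range] at h₁
    simp only [initSets, List.getElem_map, List.getElem_range, List.getElem_reverse,
      List.length_map, List.length_range]
    rw [← prefixSet_reflectConfig (List.Perm.refl _) (by omega), reflectConfig_initConfig]
    rfl

/-- If `[i₁,…,i_N]` is a stepping sequence for `m`, then so is its complement
`[m-i₁,…,m-i_N]`. -/
theorem complement_isSteppingSeq (m : ℕ) (hm : 2 ≤ m) (G : List ℕ)
    (hG : IsSteppingSeq m G) : IsSteppingSeq m (G.map (fun i => m - i)) := by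
  obtain ⟨hG, hperm⟩ := hG
  refine ⟨?_, ?_⟩
  · simp only [List.mem_map]
    rintro _ ⟨i, hi, rfl⟩
    have := hG i hi
    omega
  · have hgen : genSets m (G.map (fun i => m - i)) = (genSets m G).map (reflectCompl m) := by
      have h := genSetsAux_reflectConfig G hG (List.Perm.refl (initConfig m))
      rwa [reflectConfig_initConfig] at h
    have h := (hperm.map (reflectCompl m)).trans (map_reflectCompl_powerset_perm m)
    rw [List.map_append, map_reflectCompl_initSets, ← hgen] at h
    exact ((List.reverse_perm _).symm.append_right _).trans h
end

section
/- If [i_1,…,i_N] is a stepping sequence for m and for some index j one has |i_j − i_{j+1}| ≥ 2, then the sequence obtained by transposing the entries i_j and i_{j+1} is also a stepping sequence for m. -/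
open List

theorem length_swapAdj (q : List ℕ) (i : ℕ) : (swapAdj q i).length = q.length := by
  simp [swapAdj]

theorem getElem?_swapAdj {q : List ℕ} {i : ℕ} (hi : i < q.length) (j : ℕ) :
    (swapAdj q i)[j]? = q[Equiv.swap (i - 1) i j]? := by
  have hi' : i - 1 < q.length := by omega
  simp only [swapAdj, List.getElem?_set, List.length_set, Equiv.swap_apply_def,
    List.getD_eq_getElem?_getD]
  grind

theorem swapAdj_comm {q : List ℕ} {a b : ℕ} (ha : a < q.length) (hb : b < q.length)
    (ha1 : 1 ≤ a) (hb1 : 1 ≤ b) (hab : 2 ≤ ((a : ℤ) - (b : ℤ)).natAbs) :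
    swapAdj (swapAdj q a) b = swapAdj (swapAdj q b) a := by
  ext1 j
  rw [getElem?_swapAdj (by rwa [length_swapAdj]), getElem?_swapAdj ha,
    getElem?_swapAdj (by rwa [length_swapAdj]), getElem?_swapAdj hb]
  congr 1
  simp only [Equiv.swap_apply_def]
  grind

theorem mem_prefixSet {q : List ℕ} {k x : ℕ} :
    x ∈ prefixSet q k ↔ ∃ j < k, q[j]? = some x := by
  simp only [prefixSet, List.mem_toFinset, List.mem_iff_getElem?, List.getElem?_take]
  grind

/-- A move at index `i` changes only the prefix set of length `i`. -/
theorem prefixSet_swapAdj_of_ne {q : List ℕ} {i k : ℕ} (hi : i < q.length) (hk : k ≠ i) :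
    prefixSet (swapAdj q i) k = prefixSet q k := by
  have hlt (j : ℕ) (hj : j < k) : Equiv.swap (i - 1) i j < k := by
    rw [Equiv.swap_apply_def]
    grind
  ext x
  simp only [mem_prefixSet, getElem?_swapAdj hi]
  constructor
  · rintro ⟨j, hj, hx⟩
    exact ⟨_, hlt j hj, hx⟩
  · rintro ⟨j, hj, hx⟩
    exact ⟨_, hlt j hj, by rwa [Equiv.swap_apply_self]⟩

theorem genSetsAux_append_transpose_perm {q : List ℕ} (L R : List ℕ) {a b : ℕ}
    (ha : a < q.length) (hb : b < q.length) (ha1 : 1 ≤ a) (hb1 : 1 ≤ b)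
    (hab : 2 ≤ ((a : ℤ) - (b : ℤ)).natAbs) :
    (genSetsAux q (L ++ b :: a :: R)).Perm (genSetsAux q (L ++ a :: b :: R)) := by
  induction L generalizing q with
  | nil =>
    have hne : a ≠ b := by omega
    have hA : prefixSet (swapAdj (swapAdj q b) a) a = prefixSet (swapAdj q a) a := by
      rw [← swapAdj_comm ha hb ha1 hb1 hab,
        prefixSet_swapAdj_of_ne (by rwa [length_swapAdj]) hne]
    have hB : prefixSet (swapAdj (swapAdj q b) a) b = prefixSet (swapAdj q b) b :=
      prefixSet_swapAdj_of_ne (by rwa [length_swapAdj]) hne.symm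
    simp only [List.nil_append, genSetsAux, hA, hB, swapAdj_comm ha hb ha1 hb1 hab]
    exact List.Perm.swap _ _ _
  | cons i L ih =>
    exact (ih (by rwa [length_swapAdj]) (by rwa [length_swapAdj])).cons _

/-- Commutation: if a stepping sequence has two consecutive entries `a, b` with
`|a - b| ≥ 2`, then the sequence obtained by transposing these two entries is also a
stepping sequence for `m`. -/
theorem transpose_isSteppingSeq (m : ℕ) (hm : 2 ≤ m) (L R : List ℕ) (a b : ℕ)
    (hG : IsSteppingSeq m (L ++ a :: b :: R))
    (hab : 2 ≤ ((a : ℤ) - (b : ℤ)).natAbs) :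
    IsSteppingSeq m (L ++ b :: a :: R) := by
  have ha := hG.1 a (by simp)
  have hb := hG.1 b (by simp)
  have hlen : (initConfig m).length = m := by simp [initConfig]
  refine ⟨fun i hi => hG.1 i ?_, ?_⟩
  · simp only [List.mem_append, List.mem_cons] at hi ⊢
    tauto
  · exact ((genSetsAux_append_transpose_perm L R (by omega) (by omega) ha.1 hb.1 hab).append_left
      _).trans hG.2
end
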